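/- Let d ≥ 4 and let G be a (d+1)-critical graph with n vertices in which every vertex has degree d or d+1, the set B of vertices of degree d+1 is independent and nonempty. Then |B| ≤ ⌊(n−3)/(d−1)⌋. -/

import Mathlib

/-- A graph is `k`-critical if its chromatic number is `k` but every proper
subgraph is `(k−1)`-colorable. -/
def IsCritical {V : Type*} (G : SimpleGraph V) (k : ℕ) : Prop :=
  G.chromaticNumber = (k : ℕ∞) ∧
    ∀ H : SimpleGraph V, H ≤ G → H ≠ G → H.chromaticNumber ≤ ((k - 1 : ℕ) : ℕ∞)

theorem aux_kernel {V : Type*} [DecidableEq V] (G : SimpleGraph V) (B : Finset V)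
    (hind : ∀ u ∈ B, ∀ v ∈ B, ¬ G.Adj u v) (R : V → V → Prop)
    (h1 : ∀ u v, G.Adj u v → R u v ∨ R v u)
    (h2 : ∀ u v, u ∉ B → v ∉ B → G.Adj u v → R u v) (S : Finset V) :
    ∃ K ⊆ S, (∀ u ∈ K, ∀ v ∈ K, ¬ G.Adj u v) ∧ ∀ v ∈ S, v ∉ K → ∃ u ∈ K, R v u := by
  classical
  induction S using Finset.strongInduction with
  | H S ih =>
    by_cases h : ∀ a ∈ S, a ∉ B → ∃ b ∈ S, b ∈ B ∧ R a b
    · refine ⟨S.filter (· ∈ B), Finset.filter_subset _ _, ?_, ?_⟩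
      · intro u hu v hv
        exact hind u (Finset.mem_filter.1 hu).2 v (Finset.mem_filter.1 hv).2
      · intro v hv hvK
        have hvB : v ∉ B := fun hb => hvK (Finset.mem_filter.2 ⟨hv, hb⟩)
        obtain ⟨b, hb, hbB, hr⟩ := h v hv hvB
        exact ⟨b, Finset.mem_filter.2 ⟨hb, hbB⟩, hr⟩
    · push Not at h
      obtain ⟨a, ha, haB, hno⟩ := h
      have hin : ∀ v ∈ S, G.Adj v a → R v a := by
        intro v hv hadj
        by_cases hvB : v ∈ B
        · exact (h1 v a hadj).resolve_right (hno v hv hvB)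
        · exact h2 v a hvB haB hadj
      obtain ⟨K, hKS, hKi, hKa⟩ := ih (S.filter (fun v => v ≠ a ∧ ¬ G.Adj v a)) (by
        refine Finset.filter_ssubset.2 ⟨a, ha, by simp⟩)
      refine ⟨insert a K, ?_, ?_, ?_⟩
      · intro v hv
        rcases Finset.mem_insert.1 hv with rfl | hv
        · exact ha
        · exact (Finset.mem_filter.1 (hKS hv)).1
      · intro u hu v hv hadj
        rcases Finset.mem_insert.1 hu with rfl | hu
        · rcases Finset.mem_insert.1 hv with rfl | hv
          · exact G.loopless.irrefl _ hadj
          · exact (Finset.mem_filter.1 (hKS hv)).2.2 hadj.symm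
        · rcases Finset.mem_insert.1 hv with hva | hv
          · rw [hva] at hadj
            exact (Finset.mem_filter.1 (hKS hu)).2.2 hadj
          · exact hKi u hu v hv hadj
      · intro v hv hvK
        have hva : v ≠ a := fun h => hvK (by simp [h])
        have hvK' : v ∉ K := fun h => hvK (by simp [h])
        by_cases hadj : G.Adj v a
        · exact ⟨a, by simp, hin v hv hadj⟩
        · obtain ⟨u, hu, hr⟩ := hKa v (Finset.mem_filter.2 ⟨hv, hva, hadj⟩) hvK'
          exact ⟨u, by simp [hu], hr⟩

theorem aux_list {V α : Type*} [DecidableEq V] [DecidableEq α] [Nonempty α]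
    (G : SimpleGraph V) (R : V → V → Prop) [DecidableRel R]
    (hk : ∀ S : Finset V,
      ∃ K ⊆ S, (∀ u ∈ K, ∀ v ∈ K, ¬ G.Adj u v) ∧ ∀ v ∈ S, v ∉ K → ∃ u ∈ K, R v u)
    (S : Finset V) : ∀ L : V → Finset α,
    (∀ v ∈ S, (S.filter (R v)).card < (L v).card) →
    ∃ c : V → α, (∀ v ∈ S, c v ∈ L v) ∧ ∀ u ∈ S, ∀ v ∈ S, G.Adj u v → c u ≠ c v := by
  induction S using Finset.strongInduction with
  | H S ih =>
    intro L hL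
    rcases S.eq_empty_or_nonempty with rfl | ⟨v0, hv0⟩
    · exact ⟨fun _ => Classical.arbitrary α, by simp, by simp⟩
    obtain ⟨x, hx⟩ : (L v0).Nonempty := by
      rw [← Finset.card_pos]
      exact lt_of_le_of_lt (Nat.zero_le _) (hL v0 hv0)
    obtain ⟨K, hKS, hKi, hKa⟩ := hk (S.filter (fun v => x ∈ L v))
    have hKS' : ∀ v ∈ K, v ∈ S ∧ x ∈ L v := fun v hv => Finset.mem_filter.1 (hKS hv)
    have hKne : K.Nonempty := by
      by_cases h : v0 ∈ K
      · exact ⟨v0, h⟩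
      · obtain ⟨u, hu, _⟩ := hKa v0 (Finset.mem_filter.2 ⟨hv0, hx⟩) h
        exact ⟨u, hu⟩
    obtain ⟨k, hkK⟩ := hKne
    obtain ⟨c, hc1, hc2⟩ := ih (S \ K) (by
      refine Finset.ssubset_iff_subset_ne.2 ⟨Finset.sdiff_subset, fun h => ?_⟩
      have := (hKS' k hkK).1
      rw [← h] at this
      exact (Finset.mem_sdiff.1 this).2 hkK) (fun v => (L v).erase x) (by
      intro v hv
      obtain ⟨hvS, hvK⟩ := Finset.mem_sdiff.1 hv
      have hlt := hL v hvS
      by_cases hxv : x ∈ L v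
      · obtain ⟨u, hu, hr⟩ := hKa v (Finset.mem_filter.2 ⟨hvS, hxv⟩) hvK
        have : ((S \ K).filter (R v)).card < (S.filter (R v)).card := by
          apply Finset.card_lt_card
          refine Finset.ssubset_iff_subset_ne.2
            ⟨Finset.filter_subset_filter _ Finset.sdiff_subset, fun h => ?_⟩
          have hmem : u ∈ S.filter (R v) := Finset.mem_filter.2 ⟨(hKS' u hu).1, hr⟩
          rw [← h] at hmem
          exact (Finset.mem_sdiff.1 (Finset.mem_filter.1 hmem).1).2 hu
        rw [Finset.card_erase_of_mem hxv]
        omega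
      · rw [Finset.erase_eq_of_notMem hxv]
        exact lt_of_le_of_lt (Finset.card_le_card
          (Finset.filter_subset_filter _ Finset.sdiff_subset)) hlt)
    refine ⟨fun v => if v ∈ K then x else c v, ?_, ?_⟩
    · intro v hv
      by_cases h : v ∈ K
      · simpa [h] using (hKS' v h).2
      · simpa [h] using Finset.mem_of_mem_erase (hc1 v (Finset.mem_sdiff.2 ⟨hv, h⟩))
    · intro u hu v hv hadj
      by_cases h : u ∈ K <;> by_cases h' : v ∈ K
      · exact absurd hadj (hKi u h v h')
      · have := Finset.ne_of_mem_erase (hc1 v (Finset.mem_sdiff.2 ⟨hv, h'⟩))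
        simpa [h, h'] using this.symm
      · have := Finset.ne_of_mem_erase (hc1 u (Finset.mem_sdiff.2 ⟨hu, h⟩))
        simpa [h, h'] using this
      · simpa [h, h'] using hc2 u (Finset.mem_sdiff.2 ⟨hu, h⟩) v (Finset.mem_sdiff.2 ⟨hv, h'⟩) hadj

/-- Edges between `T \ B` and `T ∩ B`. -/
def auxE {V : Type*} [DecidableEq V] (G : SimpleGraph V) [DecidableRel G.Adj]
    (B T : Finset V) : Finset (V × V) :=
  (T ×ˢ T).filter (fun p => p.1 ∉ B ∧ p.2 ∈ B ∧ G.Adj p.1 p.2)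

theorem mem_auxE {V : Type*} [DecidableEq V] (G : SimpleGraph V) [DecidableRel G.Adj]
    (B T : Finset V) (p : V × V) : p ∈ auxE G B T ↔
      p.1 ∈ T ∧ p.2 ∈ T ∧ p.1 ∉ B ∧ p.2 ∈ B ∧ G.Adj p.1 p.2 := by
  simp [auxE, and_assoc]

/-- Weight. -/
def auxW {V : Type*} [DecidableEq V] (B T : Finset V) : ℕ :=
  T.card + (T.filter (· ∈ B)).card

theorem aux_hall {V : Type*} [DecidableEq V] (G : SimpleGraph V) [DecidableRel G.Adj]
    (B T : Finset V) (hT : auxW B T ≤ (auxE G B T).card)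
    (hmin : ∀ X ⊂ T, (auxE G B X).card ≤ auxW B X) :
    ∃ f : {x : V × Bool // x.1 ∈ T ∧ (x.2 = true → x.1 ∈ B)} → V × V,
      Function.Injective f ∧
      ∀ x, f x ∈ (auxE G B T).filter (fun p => p.1 = x.1.1 ∨ p.2 = x.1.1) := by
  classical
  refine (Finset.all_card_le_biUnion_card_iff_exists_injective
    (fun x : {x : V × Bool // x.1 ∈ T ∧ (x.2 = true → x.1 ∈ B)} =>
      (auxE G B T).filter (fun p => p.1 = x.1.1 ∨ p.2 = x.1.1))).1 ?_
  intro s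
  set X : Finset V := s.image (fun x => x.1.1) with hX
  have hXT : X ⊆ T := by
    intro v hv
    obtain ⟨x, _, rfl⟩ := Finset.mem_image.1 hv
    exact x.2.1
  rcases s.eq_empty_or_nonempty with rfl | ⟨x0, hx0⟩
  · simp
  have hx0X : x0.1.1 ∈ X := Finset.mem_image_of_mem (fun x => x.1.1) hx0
  have hss : T \ X ⊂ T := by
    refine Finset.ssubset_iff_subset_ne.2 ⟨Finset.sdiff_subset, fun h => ?_⟩
    have := h.symm.subset (hXT hx0X)
    exact (Finset.mem_sdiff.1 this).2 hx0X
  have hle := hmin _ hss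
  have hsub : auxE G B T ⊆ (s.biUnion (fun x : {x : V × Bool // x.1 ∈ T ∧ (x.2 = true → x.1 ∈ B)} =>
      (auxE G B T).filter (fun p => p.1 = x.1.1 ∨ p.2 = x.1.1))) ∪ auxE G B (T \ X) := by
    intro p hp
    by_cases hpX : p.1 ∈ X ∨ p.2 ∈ X
    · apply Finset.mem_union_left
      rw [Finset.mem_biUnion]
      rcases hpX with h | h
      · obtain ⟨x, hx, hxe⟩ := Finset.mem_image.1 h
        exact ⟨x, hx, Finset.mem_filter.2 ⟨hp, Or.inl hxe.symm⟩⟩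
      · obtain ⟨x, hx, hxe⟩ := Finset.mem_image.1 h
        exact ⟨x, hx, Finset.mem_filter.2 ⟨hp, Or.inr hxe.symm⟩⟩
    · push Not at hpX
      apply Finset.mem_union_right
      rw [mem_auxE] at hp ⊢
      simp only [Finset.mem_sdiff]
      tauto
  have hc1 := (Finset.card_le_card hsub).trans (Finset.card_union_le _ _)
  have hw : auxW B T = auxW B X + auxW B (T \ X) := by
    unfold auxW
    have e1 := Finset.card_sdiff_add_card_eq_card hXT
    have e2 := Finset.card_sdiff_add_card_eq_card
      (Finset.filter_subset_filter (fun v => v ∈ B) hXT)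
    have e3 : (T \ X).filter (· ∈ B) = T.filter (· ∈ B) \ X.filter (· ∈ B) := by
      ext v; simp only [Finset.mem_filter, Finset.mem_sdiff]; tauto
    rw [e3]
    omega
  have hs : s.card ≤ auxW B X := by
    have : s.map (Function.Embedding.subtype _) ⊆
        (X ×ˢ {false}) ∪ ((X.filter (· ∈ B)) ×ˢ {true}) := by
      intro p hp
      obtain ⟨x, hx, rfl⟩ := Finset.mem_map.1 hp
      have hxX : x.1.1 ∈ X := Finset.mem_image_of_mem (fun x => x.1.1) hx
      have := x.2.2
      simp only [Function.Embedding.subtype_apply, Finset.mem_union, Finset.mem_product,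
        Finset.mem_singleton, Finset.mem_filter]
      cases h : x.1.2
      · exact Or.inl ⟨hxX, rfl⟩
      · exact Or.inr ⟨⟨hxX, this h⟩, rfl⟩
    have h := (Finset.card_le_card this).trans (Finset.card_union_le _ _)
    simpa [auxW] using h
  omega

theorem aux_orient {V : Type*} [DecidableEq V] (G : SimpleGraph V) [DecidableRel G.Adj]
    (B T : Finset V) (hind : ∀ u ∈ B, ∀ v ∈ B, ¬ G.Adj u v)
    (hT : auxW B T ≤ (auxE G B T).card)
    (hmin : ∀ X ⊂ T, (auxE G B X).card ≤ auxW B X) :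
    ∃ R : V → V → Prop, (∀ u v, G.Adj u v → R u v ∨ R v u) ∧
      (∀ u v, u ∉ B → v ∉ B → G.Adj u v → R u v) ∧
      (∀ u v, R u v → G.Adj u v) ∧
      (∀ a ∈ T, a ∉ B → ∃ b ∈ T, G.Adj a b ∧ ¬ R a b) ∧
      (∀ b ∈ T, b ∈ B → ∃ a ∈ T, ∃ a' ∈ T, a ≠ a' ∧ G.Adj b a ∧ G.Adj b a' ∧
        ¬ R b a ∧ ¬ R b a') := by
  obtain ⟨f, hf, hft⟩ := aux_hall G B T hT hmin
  have hft' : ∀ x, (f x).1 ∈ T ∧ (f x).2 ∈ T ∧ (f x).1 ∉ B ∧ (f x).2 ∈ B ∧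
      G.Adj (f x).1 (f x).2 ∧ ((f x).1 = x.1.1 ∨ (f x).2 = x.1.1) := by
    intro x
    have h := Finset.mem_filter.1 (hft x)
    rw [mem_auxE] at h
    tauto
  let O : V × V → Prop := fun p => ∃ x, x.1.1 ∈ B ∧ f x = p
  refine ⟨fun u v => G.Adj u v ∧ ((u ∉ B ∧ v ∉ B) ∨ (u ∉ B ∧ v ∈ B ∧ O (u, v)) ∨
    (u ∈ B ∧ v ∉ B ∧ ¬ O (v, u))), ?_, ?_, ?_, ?_, ?_⟩
  · intro u v h
    have h' := h.symm
    have := hind u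
    have := this
    by_cases hu : u ∈ B <;> by_cases hv : v ∈ B
    · exact absurd h (hind u hu v hv)
    · by_cases hO : O (v, u) <;> simp [hu, hv, hO, h, h']
    · by_cases hO : O (u, v) <;> simp [hu, hv, hO, h, h']
    · simp [hu, hv, h]
  · intro u v hu hv h
    exact ⟨h, Or.inl ⟨hu, hv⟩⟩
  · intro u v h
    exact h.1
  · intro a ha haB
    obtain ⟨g1, g2, g3, g4, g5, g6⟩ := hft' ⟨(a, false), ha, by simp⟩
    set x : {x : V × Bool // x.1 ∈ T ∧ (x.2 = true → x.1 ∈ B)} := ⟨(a, false), ha, by simp⟩ with hx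
    have hxa : (f x).1 = a := by
      rcases g6 with g | g
      · exact g
      · rw [g] at g4
        exact absurd g4 haB
    refine ⟨(f x).2, g2, hxa ▸ g5, ?_⟩
    rintro ⟨_, h | h | h⟩
    · exact h.2 g4
    · obtain ⟨_, _, y, hyB, hy⟩ := h
      have : f y = f x := by rw [hy, ← hxa]
      have := hf this
      rw [this] at hyB
      exact haB hyB
    · exact haB h.1
  · intro b hb hbB
    have key : ∀ x : {x : V × Bool // x.1 ∈ T ∧ (x.2 = true → x.1 ∈ B)}, x.1.1 = b →
        (f x).2 = b ∧ (f x).1 ∈ T ∧ G.Adj b (f x).1 ∧ (f x).1 ∉ B ∧ O ((f x).1, b) := by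
      intro x hx
      obtain ⟨g1, g2, g3, g4, g5, g6⟩ := hft' x
      have hxb : (f x).2 = b := by
        rcases g6 with g | g
        · rw [g, hx] at g3
          exact absurd hbB g3
        · rw [g, hx]
      refine ⟨hxb, g1, ?_, g3, x, hx ▸ hbB, ?_⟩
      · rw [← hxb]; exact g5.symm
      · exact Prod.ext rfl hxb
    obtain ⟨p1, p2, p3, p4, p5⟩ := key ⟨(b, false), hb, by simp⟩ rfl
    obtain ⟨q1, q2, q3, q4, q5⟩ := key ⟨(b, true), hb, fun _ => hbB⟩ rfl
    refine ⟨_, p2, _, q2, ?_, p3, q3, ?_, ?_⟩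
    · intro h
      have := hf (Prod.ext h (p1.trans q1.symm))
      simp at this
    · rintro ⟨_, h | h | h⟩
      · exact h.1 hbB
      · exact h.1 hbB
      · exact h.2.2 p5
    · rintro ⟨_, h | h | h⟩
      · exact h.1 hbB
      · exact h.1 hbB
      · exact h.2.2 q5

theorem aux_main {V : Type*} [Fintype V] [DecidableEq V]
    (G : SimpleGraph V) [DecidableRel G.Adj] (d : ℕ) (hd : 4 ≤ d)
    (hcrit : IsCritical G (d + 1))
    (B : Finset V)
    (hB1 : ∀ v ∈ B, G.degree v = d + 1) (hB2 : ∀ v ∉ B, G.degree v = d)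
    (hind : ∀ u ∈ B, ∀ v ∈ B, ¬ G.Adj u v) (T : Finset V) (hTne : T.Nonempty)
    (hT : auxW B T ≤ (auxE G B T).card)
    (hmin : ∀ X ⊂ T, (auxE G B X).card ≤ auxW B X) : False := by
  classical
  obtain ⟨R, r1, r2, r3, r4, r5⟩ := aux_orient G B T hind hT hmin
  -- colouring of the rest
  let H : SimpleGraph V :=
    { Adj := fun u v => G.Adj u v ∧ u ∉ T ∧ v ∉ T
      symm := ⟨fun u v h => ⟨h.1.symm, h.2.2, h.2.1⟩⟩
      loopless := ⟨fun u h => G.loopless.irrefl _ h.1⟩ }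
  have hHG : H ≤ G := fun u v h => h.1
  obtain ⟨t, ht⟩ := hTne
  have hHne : H ≠ G := by
    intro h
    have hdt : 0 < G.degree t := by
      by_cases htB : t ∈ B
      · rw [hB1 t htB]; omega
      · rw [hB2 t htB]; omega
    obtain ⟨w, hw⟩ := (G.degree_pos_iff_exists_adj t).1 hdt
    rw [← h] at hw
    exact hw.2.1 ht
  have hHcol : H.Colorable d := by
    have := hcrit.2 H hHG hHne
    simpa using SimpleGraph.chromaticNumber_le_iff_colorable.1 this
  obtain ⟨c⟩ := hHcol
  have : Nonempty (Fin d) := ⟨⟨0, by omega⟩⟩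
  obtain ⟨c', hc1, hc2⟩ := aux_list (α := Fin d) G R (aux_kernel G B hind R r1 r2) T
    (fun v => Finset.univ \ ((G.neighborFinset v \ T).image c)) (by
      intro v hv
      have e1 : (Finset.univ : Finset (Fin d)).card - ((G.neighborFinset v \ T).image c).card ≤
        (Finset.univ \ ((G.neighborFinset v \ T).image c)).card := Finset.le_card_sdiff _ _
      have e2 : ((G.neighborFinset v \ T).image c).card ≤ (G.neighborFinset v \ T).card :=
        Finset.card_image_le
      have e3 : (G.neighborFinset v \ T).card + (T.filter (G.Adj v)).card = G.degree v := by
        have : T.filter (G.Adj v) = G.neighborFinset v ∩ T := by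
          ext w; simp [and_comm]
        rw [this, Finset.card_sdiff_add_card_inter, SimpleGraph.card_neighborFinset_eq_degree]
      rw [Finset.card_univ, Fintype.card_fin] at e1
      by_cases hvB : v ∈ B
      · obtain ⟨a, ha, a', ha', hne, h1, h2, h3, h4⟩ := r5 v hv hvB
        have hs : T.filter (R v) ⊆ ((T.filter (G.Adj v)).erase a).erase a' := by
          intro w hw
          obtain ⟨hwT, hwR⟩ := Finset.mem_filter.1 hw
          refine Finset.mem_erase.2 ⟨?_, Finset.mem_erase.2 ⟨?_, Finset.mem_filter.2 ⟨hwT, r3 _ _ hwR⟩⟩⟩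
          · rintro rfl; exact h4 hwR
          · rintro rfl; exact h3 hwR
        have hm1 : a ∈ T.filter (G.Adj v) := Finset.mem_filter.2 ⟨ha, h1⟩
        have hm2 : a' ∈ (T.filter (G.Adj v)).erase a :=
          Finset.mem_erase.2 ⟨hne.symm, Finset.mem_filter.2 ⟨ha', h2⟩⟩
        have := Finset.card_le_card hs
        have k1 := Finset.card_erase_add_one hm1
        have k2 := Finset.card_erase_add_one hm2
        have := hB1 v hvB
        omega
      · obtain ⟨b, hb, h1, h2⟩ := r4 v hv hvB
        have hs : T.filter (R v) ⊆ (T.filter (G.Adj v)).erase b := by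
          intro w hw
          obtain ⟨hwT, hwR⟩ := Finset.mem_filter.1 hw
          refine Finset.mem_erase.2 ⟨?_, Finset.mem_filter.2 ⟨hwT, r3 _ _ hwR⟩⟩
          rintro rfl; exact h2 hwR
        have hm1 : b ∈ T.filter (G.Adj v) := Finset.mem_filter.2 ⟨hb, h1⟩
        have := Finset.card_le_card hs
        have k1 := Finset.card_erase_add_one hm1
        have := hB2 v hvB
        omega)
  have hcross : ∀ u ∈ T, ∀ v, v ∉ T → G.Adj u v → c' u ≠ c v := by
    intro u hu v hv hadj h
    have := (Finset.mem_sdiff.1 (hc1 u hu)).2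
    apply this
    rw [h]
    exact Finset.mem_image_of_mem _ (Finset.mem_sdiff.2 ⟨by simpa using hadj, hv⟩)
  have hcol : G.Colorable d := by
    refine ⟨SimpleGraph.Coloring.mk (fun v => if v ∈ T then c' v else c v) ?_⟩
    intro u v hadj
    by_cases hu : u ∈ T <;> by_cases hv : v ∈ T
    · simpa [hu, hv] using hc2 u hu v hv hadj
    · simpa [hu, hv] using hcross u hu v hv hadj
    · simpa [hu, hv] using (hcross v hv u hu hadj.symm).symm
    · have : H.Adj u v := ⟨hadj, hu, hv⟩
      simpa [hu, hv] using c.valid this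
  have h1 := SimpleGraph.chromaticNumber_le_iff_colorable.2 hcol
  rw [hcrit.1] at h1
  have : d + 1 ≤ d := by exact_mod_cast h1
  omega

/-- Let `d ≥ 4` and `G` a `(d+1)`-critical `n`-vertex graph in
which every vertex has degree `d` or `d+1` and the set `B` of degree-`(d+1)`
vertices is independent and nonempty. Then `|B| ≤ ⌊(n−3)/(d−1)⌋`. -/
theorem upper_bound_high_degree {V : Type*} [Fintype V] [DecidableEq V]
    (G : SimpleGraph V) [DecidableRel G.Adj] (d : ℕ) (hd : 4 ≤ d)
    (hcrit : IsCritical G (d + 1))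
    (hdeg : ∀ v, G.degree v = d ∨ G.degree v = d + 1)
    (B : Finset V) (hB : B = Finset.univ.filter (fun v => G.degree v = d + 1))
    (hind : ∀ u ∈ B, ∀ v ∈ B, ¬ G.Adj u v)
    (hne : B.Nonempty) :
    (B.card : ℤ) ≤ ⌊((Fintype.card V : ℚ) - 3) / ((d : ℚ) - 1)⌋ := by
  classical
  have hB1 : ∀ v ∈ B, G.degree v = d + 1 := by
    intro v hv
    rw [hB] at hv
    exact (Finset.mem_filter.1 hv).2
  have hB2 : ∀ v ∉ B, G.degree v = d := by
    intro v hv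
    refine (hdeg v).resolve_right fun h => hv ?_
    rw [hB]
    exact Finset.mem_filter.2 ⟨Finset.mem_univ _, h⟩
  have hlt : (auxE G B Finset.univ).card < auxW B Finset.univ := by
    by_contra hcon
    push Not at hcon
    let P : Finset (Finset V) :=
      Finset.univ.filter (fun T => T.Nonempty ∧ auxW B T ≤ (auxE G B T).card)
    have hPne : P.Nonempty := by
      obtain ⟨b, _⟩ := hne
      exact ⟨Finset.univ, Finset.mem_filter.2 ⟨Finset.mem_univ _, ⟨b, Finset.mem_univ _⟩, hcon⟩⟩
    obtain ⟨T, hTP, hTmin⟩ := Finset.exists_min_image P Finset.card hPne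
    obtain ⟨_, hTne, hTw⟩ := Finset.mem_filter.1 hTP
    refine aux_main G d hd hcrit B hB1 hB2 hind T hTne hTw ?_
    intro X hX
    by_contra hXc
    push Not at hXc
    have hXne : X.Nonempty := by
      rw [Finset.nonempty_iff_ne_empty]
      rintro rfl
      simp [auxE] at hXc
    have := hTmin X (Finset.mem_filter.2 ⟨Finset.mem_univ _, hXne, hXc.le⟩)
    have := Finset.card_lt_card hX
    omega
  have hE : (auxE G B Finset.univ).card = B.card * (d + 1) := by
    rw [Finset.card_eq_sum_card_fiberwise (f := Prod.snd) (t := B)]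
    · rw [Finset.sum_const_nat]
      intro b hb
      rw [← hB1 b hb, ← SimpleGraph.card_neighborFinset_eq_degree]
      refine Finset.card_bij' (fun p _ => p.1) (fun a _ => (a, b)) ?_ ?_ ?_ ?_
      · rintro ⟨a, b'⟩ hp
        simp only [Finset.mem_filter, mem_auxE] at hp
        obtain ⟨⟨_, _, _, _, h⟩, rfl⟩ := hp
        simpa using h.symm
      · intro a ha
        have ha : G.Adj b a := by simpa using ha
        simp only [Finset.mem_filter, mem_auxE]
        exact ⟨⟨Finset.mem_univ _, Finset.mem_univ _, fun h => hind b hb a h ha, hb, ha.symm⟩, trivial⟩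
      · rintro ⟨a, b'⟩ hp
        simp only [Finset.mem_filter] at hp
        exact Prod.ext rfl hp.2.symm
      · intro a ha
        rfl
    · intro p hp
      exact ((mem_auxE _ _ _ _).1 hp).2.2.2.1
  have hW : auxW B Finset.univ = Fintype.card V + B.card := by
    simp [auxW]
  rw [hE, hW] at hlt
  have hpos := hne.card_pos
  have hn : d + 2 ≤ Fintype.card V := by
    obtain ⟨b, hb⟩ := hne
    have := G.degree_lt_card_verts b
    rw [hB1 b hb] at this
    omega
  have hfin : B.card * (d - 1) + 3 ≤ Fintype.card V := by
    obtain ⟨e, rfl⟩ : ∃ e, d = e + 1 := ⟨d - 1, by omega⟩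
    simp only [Nat.add_sub_cancel]
    rcases Nat.lt_or_ge 1 B.card with h | h
    · nlinarith
    · have : B.card = 1 := by omega
      rw [this]
      omega
  rw [Int.le_floor, le_div_iff₀ (by
    have : (4 : ℚ) ≤ d := by exact_mod_cast hd
    linarith)]
  have hq : ((B.card * (d - 1) + 3 : ℕ) : ℚ) ≤ (Fintype.card V : ℚ) := by exact_mod_cast hfin
  rw [Nat.cast_add, Nat.cast_mul, Nat.cast_sub (by omega)] at hq
  push_cast at hq ⊢
  linarith
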